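/- arXiv:2605.19696 — 2 statements merged into one kernel-verified Lean document; each statement's English description precedes it below -/
import Mathlib

section
/- Let d = 3 and let u ∈ ℝ³ with u ≠ 0. For a unit vector ω ∈ 𝕊² define σ(ω) := (u − 2⟨u, ω⟩ω)/|u| ∈ 𝕊². Then for every nonnegative measurable function g on 𝕊², ∫_{𝕊²} g(σ(ω)) ⟨ω, u⟩_+ dω = (|u|/4) ∫_{𝕊²} g(σ) dσ, where dω and dσ denote the surface measure on 𝕊² and ⟨ω, u⟩_+ := max(⟨ω, u⟩, 0). -/
open scoped RealInnerProductSpace ENNReal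
open MeasureTheory

namespace Scat
abbrev E := EuclideanSpace ℝ (Fin 3)

noncomputable def Phi (e x : E) : E := (‖x‖ ^ 2) • e - (2 * ⟪e, x⟫) • x

noncomputable def D (e x : E) : E →L[ℝ] E :=
  ((2:ℝ) • innerSL ℝ x).smulRight e -
    ((2 * ⟪e, x⟫) • ContinuousLinearMap.id ℝ E + ((2:ℝ) • innerSL ℝ e).smulRight x)

lemma hasFDerivAt_Phi (e x : E) : HasFDerivAt (Phi e) (D e x) x := by
  have h1 : HasFDerivAt (fun x : E => ‖x‖ ^ 2) ((2:ℝ) • innerSL ℝ x) x := by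
    have := (hasStrictFDerivAt_norm_sq x).hasFDerivAt
    rwa [← Nat.cast_smul_eq_nsmul ℝ, Nat.cast_ofNat] at this
  have h2 : HasFDerivAt (fun x : E => 2 * ⟪e, x⟫) ((2:ℝ) • innerSL ℝ e) x :=
    ((innerSL ℝ e).hasFDerivAt (x := x)).const_mul 2
  exact (h1.smul_const e).sub (h2.smul (hasFDerivAt_id x))

lemma det_D (e x : E) (he : ‖e‖ = 1) : (D e x).det = - (8 * ⟪e, x⟫ * ‖x‖ ^ 2) := by
  have he2 : e 0 ^ 2 + e 1 ^ 2 + e 2 ^ 2 = 1 := by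
    have := EuclideanSpace.norm_sq_eq e
    simp [he, Fin.sum_univ_three] at this
    exact this.symm
  have hx2 : ‖x‖ ^ 2 = x 0 ^ 2 + x 1 ^ 2 + x 2 ^ 2 := by
    have := EuclideanSpace.norm_sq_eq x
    simpa [Fin.sum_univ_three] using this
  have hi : ⟪e, x⟫ = e 0 * x 0 + e 1 * x 1 + e 2 * x 2 := by
    simp [PiLp.inner_apply, Fin.sum_univ_three]; ring
  rw [ContinuousLinearMap.det, ← LinearMap.det_toMatrix (EuclideanSpace.basisFun (Fin 3) ℝ).toBasis,
    Matrix.det_fin_three]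
  simp only [LinearMap.toMatrix_apply]
  simp [D, hx2, hi, EuclideanSpace.inner_single_right]
  linear_combination (-8 * (e 0 * x 0 + e 1 * x 1 + e 2 * x 2) *
    (x 0 ^ 2 + x 1 ^ 2 + x 2 ^ 2)) * he2

lemma norm_sq_Phi (e x : E) (he : ‖e‖ = 1) : ‖Phi e x‖ = ‖x‖ ^ 2 := by
  have : ‖Phi e x‖ ^ 2 = (‖x‖ ^ 2) ^ 2 := by
    rw [Phi, norm_sub_sq_real, norm_smul, norm_smul, inner_smul_left, inner_smul_right, he]
    simp [mul_pow]; ring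
  exact (pow_left_inj₀ (norm_nonneg _) (by positivity) two_ne_zero).1 this

lemma inner_Phi (e x : E) (he : ‖e‖ = 1) : ⟪e, Phi e x⟫ = ‖x‖ ^ 2 - 2 * ⟪e, x⟫ ^ 2 := by
  rw [Phi, inner_sub_right, inner_smul_right, inner_smul_right, real_inner_self_eq_norm_sq, he]
  ring

lemma injOn_Phi (e : E) (he : ‖e‖ = 1) : Set.InjOn (Phi e) {x | 0 < ⟪e, x⟫} := by
  intro x hx y hy h
  simp only [Set.mem_ofPred_eq] at hx hy
  have h1 : ‖x‖ ^ 2 = ‖y‖ ^ 2 := by rw [← norm_sq_Phi e x he, ← norm_sq_Phi e y he, h]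
  have h2 : ⟪e, x⟫ = ⟪e, y⟫ := by
    have a := inner_Phi e x he
    have b := inner_Phi e y he
    rw [h] at a
    have : ⟪e, x⟫ ^ 2 = ⟪e, y⟫ ^ 2 := by linarith
    exact (pow_left_inj₀ hx.le hy.le two_ne_zero).1 this
  unfold Phi at h
  rw [h1, h2] at h
  have h3 := sub_right_injective h
  exact smul_right_injective E (by positivity : (2 * ⟪e, y⟫) ≠ 0) h3

lemma mem_image_Phi (e y : E) (he : ‖e‖ = 1) (hy : y ∉ Submodule.span ℝ {e}) :
    y ∈ Phi e '' {x | 0 < ⟪e, x⟫} := by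
  have hz : ‖y‖ • e - y ≠ 0 := fun h => hy <| by
    rw [sub_eq_zero] at h
    exact Submodule.mem_span_singleton.2 ⟨_, h⟩
  have hz2 : ‖‖y‖ • e - y‖ ^ 2 = 2 * ‖y‖ * (‖y‖ - ⟪e, y⟫) := by
    rw [norm_sub_sq_real, norm_smul, inner_smul_left, he]
    simp; ring
  have hpos : 0 < ‖y‖ - ⟪e, y⟫ := by
    have : 0 < ‖‖y‖ • e - y‖ ^ 2 := by positivity
    rw [hz2] at this
    exact pos_of_mul_pos_right this (by positivity)
  set c := Real.sqrt ((‖y‖ - ⟪e, y⟫) / 2) with hc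
  have hc0 : 0 < c := Real.sqrt_pos.2 (by linarith)
  have hc2 : c ^ 2 = (‖y‖ - ⟪e, y⟫) / 2 := Real.sq_sqrt (by linarith)
  have hin : ⟪e, (2 * c)⁻¹ • (‖y‖ • e - y)⟫ = c := by
    rw [inner_smul_right, inner_sub_right, inner_smul_right, real_inner_self_eq_norm_sq, he]
    field_simp
    linarith
  have hn : ‖(2 * c)⁻¹ • (‖y‖ • e - y)‖ ^ 2 = ‖y‖ := by
    rw [norm_smul, mul_pow, hz2, Real.norm_eq_abs, sq_abs,
      show ‖y‖ - ⟪e, y⟫ = 2 * c ^ 2 by linarith]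
    field_simp
  refine ⟨(2 * c)⁻¹ • (‖y‖ • e - y), ?_, ?_⟩
  · rw [Set.mem_ofPred_eq, hin]; exact hc0
  · rw [Phi, hin, hn, smul_smul, mul_inv_cancel₀ (by positivity)]
    simp

lemma image_ae (e : E) (he : ‖e‖ = 1) :
    (Phi e '' {x | 0 < ⟪e, x⟫} : Set E) =ᵐ[volume] Set.univ := by
  rw [ae_eq_univ]
  refine measure_mono_null (t := (Submodule.span ℝ {e} : Set E)) ?_ ?_
  · intro y hy
    by_contra h
    exact hy (mem_image_Phi e y he h)
  · apply Measure.addHaar_submodule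
    intro h
    have h1 := finrank_span_le_card (R := ℝ) ({e} : Set E)
    rw [h] at h1
    simp at h1

lemma change (e : E) (he : ‖e‖ = 1) (G : E → ℝ≥0∞) :
    ∫⁻ y, G y = ∫⁻ x, ENNReal.ofReal (8 * max ⟪x, e⟫ 0 * ‖x‖ ^ 2) * G (Phi e x) := by
  have hs : MeasurableSet {x : E | 0 < ⟪e, x⟫} :=
    (isOpen_lt continuous_const (by fun_prop)).measurableSet
  rw [← setLIntegral_univ, ← setLIntegral_congr (image_ae e he),
    lintegral_image_eq_lintegral_abs_det_fderiv_mul volume hs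
      (fun x _ => (hasFDerivAt_Phi e x).hasFDerivWithinAt) (injOn_Phi e he),
    ← lintegral_indicator hs]
  refine lintegral_congr fun x => ?_
  by_cases hx : 0 < ⟪e, x⟫
  · rw [Set.indicator_of_mem (by exact hx), det_D e x he, abs_neg, abs_of_nonneg (by positivity),
      real_inner_comm e x, max_eq_left hx.le]
  · rw [Set.indicator_of_notMem (by exact hx), real_inner_comm e x, max_eq_right (not_lt.1 hx)]
    simp

lemma polar (F : E → ℝ≥0∞) (hF : Measurable F) :
    ∫⁻ x, F x = ∫⁻ ω : Metric.sphere (0 : E) 1, ∫⁻ r : Set.Ioi (0:ℝ),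
      F (r.1 • ω.1) ∂(Measure.volumeIoiPow 2) ∂((volume : Measure E).toSphere) := by
  have hmp := (volume : Measure E).measurePreserving_homeomorphUnitSphereProd
  have h3 : Module.finrank ℝ E - 1 = 2 := by simp
  rw [h3] at hmp
  have hm : Measurable fun p : Metric.sphere (0:E) 1 × Set.Ioi (0:ℝ) => F (p.2.1 • p.1.1) :=
    hF.comp (by fun_prop)
  rw [← lintegral_prod (fun p : Metric.sphere (0:E) 1 × Set.Ioi (0:ℝ) => F (p.2.1 • p.1.1))
    hm.aemeasurable, ← hmp.lintegral_comp hm]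
  have : ∀ x : ({0}ᶜ : Set E), F ((homeomorphUnitSphereProd E x).2.1 •
      (homeomorphUnitSphereProd E x).1.1) = F x := by
    intro x
    have hx : ‖(x:E)‖ ≠ 0 := norm_ne_zero_iff.2 x.2
    simp [smul_smul, hx]
  simp_rw [this]
  rw [lintegral_subtype_comap (measurableSet_singleton _).compl, restrict_compl_singleton]

lemma pow2 : (∫⁻ r : Set.Ioi (0:ℝ), (Set.Iio (1:ℝ)).indicator 1 r.1 ∂(Measure.volumeIoiPow 2)) =
    ENNReal.ofReal (1 / 3) := by
  have := Measure.volumeIoiPow_apply_Iio 2 ⟨1, Set.mem_Ioi.2 one_pos⟩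
  rw [← lintegral_indicator_one measurableSet_Iio] at this
  convert this using 2
  · rfl
  · norm_num

lemma pow5 : (∫⁻ r : Set.Ioi (0:ℝ), ENNReal.ofReal (r.1 ^ 3) * (Set.Iio (1:ℝ)).indicator 1 r.1
    ∂(Measure.volumeIoiPow 2)) = ENNReal.ofReal (1 / 6) := by
  have := Measure.volumeIoiPow_apply_Iio 5 ⟨1, Set.mem_Ioi.2 one_pos⟩
  rw [← lintegral_indicator_one measurableSet_Iio, Measure.volumeIoiPow,
    lintegral_withDensity_eq_lintegral_mul _ (by fun_prop)
      (measurable_one.indicator measurableSet_Iio)] at this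
  have hm : Measurable fun r : Set.Ioi (0:ℝ) => ENNReal.ofReal (r.1 ^ 3) *
      (Set.Iio (1:ℝ)).indicator (1 : ℝ → ℝ≥0∞) r.1 :=
    Measurable.mul (by fun_prop)
      ((measurable_one.indicator measurableSet_Iio).comp measurable_subtype_coe)
  rw [Measure.volumeIoiPow, lintegral_withDensity_eq_lintegral_mul _ (by fun_prop) hm]
  convert this using 2
  · ext r
    have hr : (0:ℝ) < r.1 := r.2
    simp only [Pi.mul_apply]
    rw [← mul_assoc, ← ENNReal.ofReal_mul (by positivity), ← pow_add]
    rfl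
  · norm_num

lemma unit_case (e : E) (he : ‖e‖ = 1) (g : E → ℝ≥0∞) (hg : Measurable g) :
    4 * ∫⁻ ω : Metric.sphere (0 : E) 1, g (e - (2 * ⟪e, (ω : E)⟫) • (ω : E))
          * ENNReal.ofReal (max ⟪(ω : E), e⟫ 0) ∂((volume : Measure E).toSphere)
      = ∫⁻ σ : Metric.sphere (0 : E) 1, g (σ : E) ∂((volume : Measure E).toSphere) := by
  have hchi : Measurable ((Set.Iio (1:ℝ)).indicator (1 : ℝ → ℝ≥0∞)) :=
    measurable_one.indicator measurableSet_Iio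
  set G : E → ℝ≥0∞ := fun y => g (‖y‖⁻¹ • y) * (Set.Iio (1:ℝ)).indicator 1 ‖y‖ with hG
  have hGm : Measurable G :=
    (hg.comp (by fun_prop)).mul (hchi.comp measurable_norm)
  have hPhi : Measurable (Phi e) := by unfold Phi; fun_prop
  have key := change e he G
  have hm2 : Measurable fun x : E =>
      ENNReal.ofReal (8 * max ⟪x, e⟫ 0 * ‖x‖ ^ 2) * G (Phi e x) :=
    Measurable.mul (by fun_prop) (hGm.comp hPhi)
  rw [polar G hGm, polar _ hm2] at key
  have hn : ∀ ω : Metric.sphere (0:E) 1, ‖ω.1‖ = 1 := fun ω => by simp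
  have h1 : ∀ ω : Metric.sphere (0:E) 1, (∫⁻ r : Set.Ioi (0:ℝ), G (r.1 • ω.1)
      ∂(Measure.volumeIoiPow 2)) = g ω * ENNReal.ofReal (1/3) := by
    intro ω
    rw [← pow2, ← lintegral_const_mul]
    swap
    · exact hchi.comp measurable_subtype_coe
    refine lintegral_congr fun r => ?_
    have hr : (0:ℝ) < r.1 := r.2
    have hr' : ‖r.1 • ω.1‖ = r.1 := by rw [norm_smul, hn, mul_one, Real.norm_of_nonneg hr.le]
    simp only [hG, hr', smul_smul, inv_mul_cancel₀ hr.ne', one_smul]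
  have h2 : ∀ ω : Metric.sphere (0:E) 1, (∫⁻ r : Set.Ioi (0:ℝ),
      ENNReal.ofReal (8 * max ⟪r.1 • ω.1, e⟫ 0 * ‖r.1 • ω.1‖ ^ 2) * G (Phi e (r.1 • ω.1))
      ∂(Measure.volumeIoiPow 2)) = (g (e - (2 * ⟪e, (ω : E)⟫) • (ω : E))
          * ENNReal.ofReal (max ⟪(ω : E), e⟫ 0)) * (8 * ENNReal.ofReal (1/6)) := by
    intro ω
    rw [← pow5, ← mul_assoc, ← lintegral_const_mul]
    swap
    · exact Measurable.mul (by fun_prop) (hchi.comp measurable_subtype_coe)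
    refine lintegral_congr fun r => ?_
    have hr : (0:ℝ) < r.1 := r.2
    have hr' : ‖r.1 • ω.1‖ = r.1 := by rw [norm_smul, hn, mul_one, Real.norm_of_nonneg hr.le]
    have hP : Phi e (r.1 • ω.1) = r.1 ^ 2 • (e - (2 * ⟪e, (ω : E)⟫) • (ω : E)) := by
      rw [Phi, hr', inner_smul_right, smul_sub, smul_smul, smul_smul]
      congr 2; ring
    have hPn : ‖Phi e (r.1 • ω.1)‖ = r.1 ^ 2 := by rw [norm_sq_Phi e _ he, hr']
    have hi : (Set.Iio (1:ℝ)).indicator (1 : ℝ → ℝ≥0∞) (r.1 ^ 2) =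
        (Set.Iio (1:ℝ)).indicator (1 : ℝ → ℝ≥0∞) r.1 := by
      have : r.1 ^ 2 ∈ Set.Iio (1:ℝ) ↔ r.1 ∈ Set.Iio (1:ℝ) := by
        simp only [Set.mem_Iio]
        exact pow_lt_one_iff_of_nonneg hr.le two_ne_zero
      simp only [Set.indicator, this]; rfl
    have hmx : max ⟪r.1 • ω.1, e⟫ 0 = r.1 * max ⟪ω.1, e⟫ 0 := by
      rw [real_inner_smul_left, mul_max_of_nonneg _ _ hr.le, mul_zero]
    simp only [hG, hPn, hi]
    rw [hP, smul_smul, inv_mul_cancel₀ (by positivity), one_smul, hr', hmx,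
      show 8 * (r.1 * max ⟪ω.1, e⟫ 0) * r.1 ^ 2 = max ⟪ω.1, e⟫ 0 * 8 * r.1 ^ 3 by ring,
      ENNReal.ofReal_mul (by positivity), ENNReal.ofReal_mul (by positivity)]
    simp only [ENNReal.ofReal_ofNat]
    ring
  simp_rw [h1, h2] at key
  have m1 : Measurable fun ω : Metric.sphere (0 : E) 1 => g ω.1 := hg.comp measurable_subtype_coe
  have m2 : Measurable fun ω : Metric.sphere (0 : E) 1 => g (e - (2 * ⟪e, (ω : E)⟫) • (ω : E))
      * ENNReal.ofReal (max ⟪(ω : E), e⟫ 0) :=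
    Measurable.mul (hg.comp (by fun_prop)) (by fun_prop)
  rw [lintegral_mul_const _ m1, lintegral_mul_const _ m2] at key
  have h8 : (8:ℝ≥0∞) * ENNReal.ofReal (1/6) = 4 * ENNReal.ofReal (1/3) := by
    rw [← ENNReal.ofReal_ofNat 8, ← ENNReal.ofReal_ofNat 4, ← ENNReal.ofReal_mul (by norm_num),
      ← ENNReal.ofReal_mul (by norm_num)]
    norm_num
  rw [h8, ← mul_assoc] at key
  have h3 : ENNReal.ofReal (1/3) ≠ 0 := by simp
  rw [ENNReal.mul_left_inj h3 ENNReal.ofReal_ne_top] at key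
  rw [key, mul_comm]

end Scat

theorem change_of_scattering_angle (u : EuclideanSpace ℝ (Fin 3)) (hu : u ≠ 0)
    (g : EuclideanSpace ℝ (Fin 3) → ℝ≥0∞) (hg : Measurable g) :
    ∫⁻ ω : Metric.sphere (0 : EuclideanSpace ℝ (Fin 3)) 1,
        g (‖u‖⁻¹ • (u - (2 * ⟪u, (ω : EuclideanSpace ℝ (Fin 3))⟫) •
            (ω : EuclideanSpace ℝ (Fin 3))))
          * ENNReal.ofReal (max ⟪(ω : EuclideanSpace ℝ (Fin 3)), u⟫ 0)
        ∂((volume : Measure (EuclideanSpace ℝ (Fin 3))).toSphere)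
      = ENNReal.ofReal (‖u‖ / 4)
        * ∫⁻ σ : Metric.sphere (0 : EuclideanSpace ℝ (Fin 3)) 1,
            g (σ : EuclideanSpace ℝ (Fin 3))
          ∂((volume : Measure (EuclideanSpace ℝ (Fin 3))).toSphere) := by

  have hn : 0 < ‖u‖ := norm_pos_iff.2 hu
  set e : EuclideanSpace ℝ (Fin 3) := ‖u‖⁻¹ • u with he
  have he1 : ‖e‖ = 1 := by rw [he, norm_smul, norm_inv, norm_norm, inv_mul_cancel₀ hn.ne']
  have hue : u = ‖u‖ • e := by rw [he, smul_smul, mul_inv_cancel₀ hn.ne', one_smul]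
  rw [← Scat.unit_case e he1 g hg, ← mul_assoc, ← ENNReal.ofReal_ofNat 4,
    ← ENNReal.ofReal_mul (by positivity), div_mul_cancel₀ _ (by norm_num),
    ← lintegral_const_mul' _ _ ENNReal.ofReal_ne_top]
  refine lintegral_congr fun ω => ?_
  have h1 : ‖u‖⁻¹ • (u - (2 * ⟪u, (ω : EuclideanSpace ℝ (Fin 3))⟫) •
      (ω : EuclideanSpace ℝ (Fin 3))) = e - (2 * ⟪e, (ω : EuclideanSpace ℝ (Fin 3))⟫) •
      (ω : EuclideanSpace ℝ (Fin 3)) := by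
    rw [smul_sub, smul_smul, he, real_inner_smul_left]
    congr 2; ring
  have h2 : max ⟪(ω : EuclideanSpace ℝ (Fin 3)), u⟫ 0 =
      ‖u‖ * max ⟪(ω : EuclideanSpace ℝ (Fin 3)), e⟫ 0 := by
    rw [mul_max_of_nonneg _ _ hn.le, mul_zero, ← real_inner_smul_right, ← hue]
  rw [h1, h2, ENNReal.ofReal_mul hn.le]
  ring
end

section
/- Let d ≥ 2, let u ∈ ℝ^d with u ≠ 0, let ε > 0 and T > 0. Define A := { (τ, ω) ∈ (0, T) × 𝕊^{d−1} : ⟨u, ω⟩ > 0 } and Φ(τ, ω) := ε ω − τ u ∈ ℝ^d. Then Φ is injective on A, and for every nonnegative measurable f : ℝ^d → [0, ∞], ∫_A f(Φ(τ, ω)) · ε^{d−1} ⟨u, ω⟩ dω dτ = ∫_{Φ(A)} f(x) dx, where dω is the surface measure on 𝕊^{d−1} and dx is Lebesgue measure on ℝ^d. In particular the left-hand side is at most ∫_{ℝ^d} f(x) dx. -/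
open scoped RealInnerProductSpace ENNReal
open MeasureTheory

open Set in
/-- Polar coordinates for nonnegative functions. -/
lemma polar_lintegral_aux (d : ℕ) (hd : 2 ≤ d) (g : EuclideanSpace ℝ (Fin d) → ℝ≥0∞)
    (hg : Measurable g) :
    ∫⁻ x, g x = ∫⁻ p in (Set.Ioi (0 : ℝ)) ×ˢ (Set.univ : Set (Metric.sphere (0 : EuclideanSpace ℝ (Fin d)) 1)),
      ENNReal.ofReal (p.1 ^ (d - 1)) * g (p.1 • (p.2 : EuclideanSpace ℝ (Fin d)))
      ∂((volume : Measure ℝ).prod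
              ((volume : Measure (EuclideanSpace ℝ (Fin d))).toSphere)) := by
  have : Nonempty (Fin d) := ⟨⟨0, by omega⟩⟩
  have : Nontrivial (EuclideanSpace ℝ (Fin d)) := inferInstance
  have hm : Measurable (fun p : ℝ × Metric.sphere (0 : EuclideanSpace ℝ (Fin d)) 1 =>
      g (p.1 • (p.2 : EuclideanSpace ℝ (Fin d)))) := hg.comp (by fun_prop)
  have hm2 : Measurable (fun p : Metric.sphere (0 : EuclideanSpace ℝ (Fin d)) 1 × Ioi (0 : ℝ) =>
      g (p.2.1 • (p.1 : EuclideanSpace ℝ (Fin d)))) := hg.comp (by fun_prop)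
  have h1 : ∫⁻ x, g x = ∫⁻ x : ({(0 : EuclideanSpace ℝ (Fin d))}ᶜ : Set _), g x
      ∂((volume : Measure (EuclideanSpace ℝ (Fin d))).comap (↑)) := by
    rw [lintegral_subtype_comap (measurableSet_singleton _).compl, restrict_compl_singleton]
  have h2 := (volume : Measure (EuclideanSpace ℝ (Fin d))).measurePreserving_homeomorphUnitSphereProd.lintegral_comp hm2
  rw [finrank_euclideanSpace_fin] at h2
  have h3 : ∀ x : ({(0 : EuclideanSpace ℝ (Fin d))}ᶜ : Set _),
      ((homeomorphUnitSphereProd (EuclideanSpace ℝ (Fin d)) x).2 : ℝ) •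
        ((homeomorphUnitSphereProd (EuclideanSpace ℝ (Fin d)) x).1 : EuclideanSpace ℝ (Fin d)) = x := by
    intro x
    have hx : ‖(x : EuclideanSpace ℝ (Fin d))‖ ≠ 0 := norm_ne_zero_iff.2 x.2
    simp [smul_smul, hx]
  simp only [h3] at h2
  rw [h1, h2, lintegral_prod_symm _ hm2.aemeasurable]
  rw [← Measure.prod_restrict, Measure.restrict_univ, lintegral_prod _ (by fun_prop)]
  have h4 : ∀ r : ℝ, ∫⁻ ω : Metric.sphere (0 : EuclideanSpace ℝ (Fin d)) 1,
      ENNReal.ofReal (r ^ (d - 1)) * g (r • (ω : EuclideanSpace ℝ (Fin d)))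
        ∂((volume : Measure (EuclideanSpace ℝ (Fin d))).toSphere)
      = ENNReal.ofReal (r ^ (d - 1)) * ∫⁻ ω : Metric.sphere (0 : EuclideanSpace ℝ (Fin d)) 1,
         g (r • (ω : EuclideanSpace ℝ (Fin d)))
        ∂((volume : Measure (EuclideanSpace ℝ (Fin d))).toSphere) := by
    intro r
    rw [lintegral_const_mul]
    exact hm.comp (measurable_prodMk_left)
  simp only [h4]
  rw [Measure.volumeIoiPow, lintegral_withDensity_eq_lintegral_mul _ (by fun_prop)
    (hm2.lintegral_prod_left'), ← lintegral_subtype_comap measurableSet_Ioi]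
  rfl

/-- Injectivity of the encounter map. -/
lemma encounter_inj_aux {d : ℕ} (u : EuclideanSpace ℝ (Fin d)) {ε : ℝ} (hε : 0 < ε)
    {v w : EuclideanSpace ℝ (Fin d)} (hv : ‖v‖ = 1) (hw : ‖w‖ = 1) {s t : ℝ}
    (huv : 0 < ⟪u, v⟫) (huw : 0 < ⟪u, w⟫) (h : ε • v - s • u = ε • w - t • u) :
    s = t ∧ v = w := by
  have h1 : ε • (v - w) = (s - t) • u := by
    rw [smul_sub, sub_smul]
    have h' := sub_eq_zero.2 h
    rw [← sub_eq_zero, ← h']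
    abel
  have h2 : (s - t) * ⟪u, v + w⟫ = 0 := by
    rw [← real_inner_smul_left, ← h1, real_inner_smul_left, inner_add_right, inner_sub_left,
      inner_sub_left, real_inner_self_eq_norm_sq, real_inner_self_eq_norm_sq, hv, hw,
      real_inner_comm v w]
    ring
  rw [inner_add_right] at h2
  have h3 : s = t := by
    rcases mul_eq_zero.1 h2 with h | h <;> linarith
  refine ⟨h3, ?_⟩
  rw [h3, sub_self, zero_smul] at h1
  exact sub_eq_zero.1 ((smul_eq_zero.1 h1).resolve_left hε.ne')

/-- Derivative of the encounter map in polar form, with its determinant. -/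
lemma encounter_deriv_aux {d : ℕ} (hd : 2 ≤ d) (u : EuclideanSpace ℝ (Fin d)) {ε : ℝ} (hε : 0 < ε)
    (x : EuclideanSpace ℝ (Fin d)) (hx : x ≠ 0) :
    ∃ L : EuclideanSpace ℝ (Fin d) →L[ℝ] EuclideanSpace ℝ (Fin d),
      HasFDerivAt (fun y : EuclideanSpace ℝ (Fin d) => ε • (‖y‖⁻¹ • y) - ‖y‖ • u) L x ∧
      L.det = - ((ε / ‖x‖) ^ (d - 1) * (⟪u, x⟫ / ‖x‖)) := by
  have hn : ‖x‖ ≠ 0 := norm_ne_zero_iff.2 hx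
  have hnorm : HasFDerivAt (fun y : EuclideanSpace ℝ (Fin d) => ‖y‖) (‖x‖⁻¹ • innerSL ℝ x) x := by
    have h := ((hasStrictFDerivAt_norm_sq x).hasFDerivAt).sqrt (by positivity)
    simp only [Real.sqrt_sq (norm_nonneg _)] at h
    have e : ‖x‖⁻¹ • innerSL ℝ x = (1 / (2 * ‖x‖)) • 2 • innerSL ℝ x := ?_
    · rw [e]; exact h
    rw [two_smul, smul_add, ← add_smul]
    congr 1
    field_simp
    norm_num
  have hinv := (hasDerivAt_inv hn).comp_hasFDerivAt x hnorm
  have h := ((hinv.smul (hasFDerivAt_id x)).const_smul ε).sub (hnorm.smul_const u)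
  refine ⟨_, h, ?_⟩
  rw [ContinuousLinearMap.det]
  have key : ∀ L : EuclideanSpace ℝ (Fin d) →L[ℝ] EuclideanSpace ℝ (Fin d),
    (L : EuclideanSpace ℝ (Fin d) →ₗ[ℝ] EuclideanSpace ℝ (Fin d)) = (ε / ‖x‖) •
      LinearMap.transvection ((innerSL ℝ x : EuclideanSpace ℝ (Fin d) →L[ℝ] ℝ) : EuclideanSpace ℝ (Fin d) →ₗ[ℝ] ℝ)
        (-((‖x‖ ^ 2)⁻¹ • x) - ε⁻¹ • u) → LinearMap.det (L : EuclideanSpace ℝ (Fin d) →ₗ[ℝ] EuclideanSpace ℝ (Fin d))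
        = - ((ε / ‖x‖) ^ (d - 1) * (⟪u, x⟫ / ‖x‖)) := by
    intro L hL
    obtain ⟨n, rfl⟩ : ∃ n, d = n + 1 := ⟨d - 1, by omega⟩
    rw [hL, LinearMap.det_smul, LinearMap.transvection.det, finrank_euclideanSpace_fin]
    simp only [ContinuousLinearMap.coe_coe, innerSL_apply_apply, inner_sub_right, inner_neg_right,
      real_inner_smul_right, real_inner_self_eq_norm_sq, real_inner_comm u x, Nat.add_sub_cancel, pow_succ]
    field_simp
    ring
  apply key
  ext1 y
  simp [LinearMap.transvection.apply]
  match_scalars <;> field_simp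

/-- **Change of variables harnessing a clustering encounter** (Section 2.6):
with `Φ(τ, ω) = εω − τu` on `A = {(τ, ω) ∈ (0,T) × 𝕊^{d−1} : ⟨u, ω⟩ > 0}`,
`Φ` is injective on `A` and
`∫_A f(Φ(τ,ω)) ε^{d−1} ⟨u,ω⟩ dω dτ = ∫_{Φ(A)} f(x) dx ≤ ∫_{ℝᵈ} f(x) dx`. -/
theorem encounter_change_of_variables (d : ℕ) (hd : 2 ≤ d)
    (u : EuclideanSpace ℝ (Fin d)) (hu : u ≠ 0) (ε T : ℝ) (hε : 0 < ε) (hT : 0 < T) :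
    Set.InjOn
      (fun p : ℝ × Metric.sphere (0 : EuclideanSpace ℝ (Fin d)) 1 =>
        ε • (p.2 : EuclideanSpace ℝ (Fin d)) - p.1 • u)
      {p | p.1 ∈ Set.Ioo 0 T ∧ 0 < ⟪u, (p.2 : EuclideanSpace ℝ (Fin d))⟫} ∧
    ∀ f : EuclideanSpace ℝ (Fin d) → ℝ≥0∞, Measurable f →
      (∫⁻ p in {p : ℝ × Metric.sphere (0 : EuclideanSpace ℝ (Fin d)) 1 |
            p.1 ∈ Set.Ioo 0 T ∧ 0 < ⟪u, (p.2 : EuclideanSpace ℝ (Fin d))⟫},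
          f (ε • (p.2 : EuclideanSpace ℝ (Fin d)) - p.1 • u)
            * ENNReal.ofReal (ε ^ (d - 1) * ⟪u, (p.2 : EuclideanSpace ℝ (Fin d))⟫)
          ∂((volume : Measure ℝ).prod
              ((volume : Measure (EuclideanSpace ℝ (Fin d))).toSphere)))
        = (∫⁻ x in (fun p : ℝ × Metric.sphere (0 : EuclideanSpace ℝ (Fin d)) 1 =>
              ε • (p.2 : EuclideanSpace ℝ (Fin d)) - p.1 • u) ''
              {p | p.1 ∈ Set.Ioo 0 T ∧ 0 < ⟪u, (p.2 : EuclideanSpace ℝ (Fin d))⟫},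
            f x)
      ∧ (∫⁻ p in {p : ℝ × Metric.sphere (0 : EuclideanSpace ℝ (Fin d)) 1 |
            p.1 ∈ Set.Ioo 0 T ∧ 0 < ⟪u, (p.2 : EuclideanSpace ℝ (Fin d))⟫},
          f (ε • (p.2 : EuclideanSpace ℝ (Fin d)) - p.1 • u)
            * ENNReal.ofReal (ε ^ (d - 1) * ⟪u, (p.2 : EuclideanSpace ℝ (Fin d))⟫)
          ∂((volume : Measure ℝ).prod
              ((volume : Measure (EuclideanSpace ℝ (Fin d))).toSphere)))
        ≤ ∫⁻ x, f x := by
  have hinj : Set.InjOn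
      (fun p : ℝ × Metric.sphere (0 : EuclideanSpace ℝ (Fin d)) 1 =>
        ε • (p.2 : EuclideanSpace ℝ (Fin d)) - p.1 • u)
      {p | p.1 ∈ Set.Ioo 0 T ∧ 0 < ⟪u, (p.2 : EuclideanSpace ℝ (Fin d))⟫} := by
    rintro ⟨s, v⟩ ⟨_, hv⟩ ⟨t, w⟩ ⟨_, hw⟩ h
    obtain ⟨h1, h2⟩ := encounter_inj_aux u hε (by simp) (by simp) hv hw h
    exact Prod.ext h1 (Subtype.ext h2)
  refine ⟨hinj, fun f hf => ?_⟩
  refine (fun h => ⟨h, h.trans_le (setLIntegral_le_lintegral _ _)⟩) ?_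
  set A : Set (ℝ × Metric.sphere (0 : EuclideanSpace ℝ (Fin d)) 1) :=
    {p | p.1 ∈ Set.Ioo 0 T ∧ 0 < ⟪u, (p.2 : EuclideanSpace ℝ (Fin d))⟫} with hA
  have hAm : MeasurableSet A := by
    apply IsOpen.measurableSet
    apply IsOpen.inter
    · exact isOpen_Ioo.preimage continuous_fst
    · exact isOpen_lt (g := fun p : ℝ × Metric.sphere (0 : EuclideanSpace ℝ (Fin d)) 1 =>
        ⟪u, (p.2 : EuclideanSpace ℝ (Fin d))⟫) continuous_const (by fun_prop)
  set S : Set (EuclideanSpace ℝ (Fin d)) := {x | ‖x‖ < T ∧ 0 < ⟪u, x⟫} with hS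
  have hSm : MeasurableSet S := by
    apply IsOpen.measurableSet
    apply IsOpen.inter
    · exact isOpen_lt continuous_norm continuous_const
    · exact isOpen_lt (g := fun x : EuclideanSpace ℝ (Fin d) => ⟪u, x⟫) continuous_const (by fun_prop)
  have hS0 : ∀ x ∈ S, x ≠ 0 := by
    rintro x ⟨_, hx⟩ rfl
    simp at hx
  set F : EuclideanSpace ℝ (Fin d) → EuclideanSpace ℝ (Fin d) :=
    fun y => ε • (‖y‖⁻¹ • y) - ‖y‖ • u with hF
  have hex : ∀ x, ∃ L : EuclideanSpace ℝ (Fin d) →L[ℝ] EuclideanSpace ℝ (Fin d),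
      x ≠ 0 → (HasFDerivAt F L x ∧
      L.det = - ((ε / ‖x‖) ^ (d - 1) * (⟪u, x⟫ / ‖x‖))) := by
    intro x
    by_cases hx : x = 0
    · exact ⟨0, fun h => absurd hx h⟩
    · obtain ⟨L, hL⟩ := encounter_deriv_aux hd u hε x hx
      exact ⟨L, fun _ => hL⟩
  choose F' hF' using hex
  have hunit : ∀ x ∈ S, ‖‖x‖⁻¹ • x‖ = 1 := fun x hx => by
    have := norm_ne_zero_iff.2 (hS0 x hx)
    rw [norm_smul, norm_inv, norm_norm, inv_mul_cancel₀ this]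
  have hpos : ∀ x ∈ S, 0 < ⟪u, ‖x‖⁻¹ • x⟫ := fun x hx => by
    have := norm_pos_iff.2 (hS0 x hx)
    have h2 := hx.2
    rw [real_inner_smul_right]
    positivity
  have hFinj : Set.InjOn F S := by
    intro x hx y hy h
    obtain ⟨h1, h2⟩ := encounter_inj_aux u hε (hunit x hx) (hunit y hy) (hpos x hx) (hpos y hy) h
    rw [h1] at h2
    have := norm_ne_zero_iff.2 (hS0 y hy)
    exact smul_right_injective _ (inv_ne_zero this) h2
  have himg : (fun p : ℝ × Metric.sphere (0 : EuclideanSpace ℝ (Fin d)) 1 =>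
        ε • (p.2 : EuclideanSpace ℝ (Fin d)) - p.1 • u) '' A = F '' S := by
    ext z
    constructor
    · rintro ⟨⟨t, w⟩, ⟨ht, hw⟩, rfl⟩
      have hn : ‖t • (w : EuclideanSpace ℝ (Fin d))‖ = t := by
        rw [norm_smul]; simp [abs_of_pos ht.1]
      refine ⟨t • (w : EuclideanSpace ℝ (Fin d)), ⟨by rw [hn]; exact ht.2, ?_⟩, ?_⟩
      · rw [real_inner_smul_right]; exact mul_pos ht.1 hw
      · simp only [hF, hn, inv_smul_smul₀ ht.1.ne']
    · rintro ⟨x, hx, rfl⟩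
      exact ⟨(‖x‖, ⟨‖x‖⁻¹ • x, by simpa using hunit x hx⟩),
        ⟨⟨norm_pos_iff.2 (hS0 x hx), hx.1⟩, hpos x hx⟩, rfl⟩
  rw [himg, lintegral_image_eq_lintegral_abs_det_fderiv_mul volume hSm
    (fun x hx => (hF' x (hS0 x hx)).1.hasFDerivWithinAt) hFinj f]
  have hcongr : ∫⁻ x in S, ENNReal.ofReal |(F' x).det| * f (F x)
      = ∫⁻ x in S, ENNReal.ofReal ((ε / ‖x‖) ^ (d - 1) * (⟪u, x⟫ / ‖x‖)) * f (F x) := by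
    refine setLIntegral_congr_fun hSm (fun x hx => ?_)
    have := hx.2
    rw [(hF' x (hS0 x hx)).2, abs_neg, abs_of_nonneg (by positivity)]
  have hFm : Measurable F := by
    simp only [hF]; fun_prop
  have hfF : Measurable (fun x => f (F x)) := hf.comp hFm
  rw [hcongr, ← lintegral_indicator hSm, polar_lintegral_aux d hd _
    (Measurable.indicator (by fun_prop) hSm), ← lintegral_indicator hAm,
    ← lintegral_indicator (measurableSet_Ioi.prod MeasurableSet.univ)]
  congr 1
  ext ⟨t, w⟩
  by_cases ht : 0 < t
  swap
  · rw [Set.indicator_of_notMem (fun h => ht h.1.1), Set.indicator_of_notMem (fun h => ht h.1)]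
  have hn : ‖t • (w : EuclideanSpace ℝ (Fin d))‖ = t := by
    rw [norm_smul]; simp [abs_of_pos ht]
  have hmem : (t, w) ∈ Set.Ioi (0 : ℝ) ×ˢ
      (Set.univ : Set (Metric.sphere (0 : EuclideanSpace ℝ (Fin d)) 1)) := ⟨ht, trivial⟩
  rw [Set.indicator_of_mem hmem]
  have hiff : (t, w) ∈ A ↔ t • (w : EuclideanSpace ℝ (Fin d)) ∈ S := by
    simp only [hA, hS, Set.mem_ofPred_eq, Set.mem_Ioo, hn, real_inner_smul_right]
    rw [mul_pos_iff_of_pos_left ht]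
    tauto
  by_cases hm : (t, w) ∈ A
  · rw [Set.indicator_of_mem hm, Set.indicator_of_mem (hiff.1 hm), ← mul_assoc,
      ← ENNReal.ofReal_mul (by positivity), mul_comm]
    simp only [hF, hn, inv_smul_smul₀ ht.ne', real_inner_smul_right]
    congr 2
    rw [div_pow]
    field_simp
  · rw [Set.indicator_of_notMem hm, Set.indicator_of_notMem (fun h => hm (hiff.2 h)), mul_zero]
end
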